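/- For every real number t with 0 < |t| < 2π, the series Σ_{n=1}^{∞} (−1)^{n−1}(1 − 2^{1−2n}) B_{2n} t^{2n}/(2n)! converges and (t/2)/sin(t/2) = 1 + Σ_{n=1}^{∞} (−1)^{n−1}(1 − 2^{1−2n}) B_{2n} · t^{2n}/(2n)!. -/

import Mathlib

open Real

/-- `|B_{2k} / (2k)!| ≤ (π ^ 2 / 3) / (2π) ^ (2k)`, from `ζ(2k) ≤ ζ(2)`. -/
lemma abs_bernoulli_two_mul_div_factorial_le {k : ℕ} (hk : k ≠ 0) :
    |(bernoulli (2 * k) : ℝ) / ((2 * k).factorial : ℝ)| ≤ π ^ 2 / 3 / (2 * π) ^ (2 * k) := by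
  have h := hasSum_zeta_nat hk
  have hle := hasSum_le (fun n : ℕ => ?_) h hasSum_zeta_two
  · have hnn := h.nonneg (fun n => by positivity)
    have hp : (0 : ℝ) < (2 * π) ^ (2 * k) := by positivity
    rw [le_div_iff₀ hp, ← abs_of_pos hp, ← abs_mul]
    have e : |(bernoulli (2 * k) : ℝ) / ((2 * k).factorial : ℝ) * (2 * π) ^ (2 * k)| =
        2 * |(-1 : ℝ) ^ (k + 1) * (2 : ℝ) ^ (2 * k - 1) * π ^ (2 * k) *
          bernoulli (2 * k) / (2 * k).factorial| := by
      obtain ⟨j, rfl⟩ := Nat.exists_eq_succ_of_ne_zero hk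
      simp only [abs_mul, abs_div, abs_pow, abs_neg, abs_one, one_pow, mul_pow]
      rw [show 2 * j.succ = 2 * j.succ - 1 + 1 by omega, pow_succ (|2| : ℝ)]
      simp
      ring
    rw [e, abs_of_nonneg hnn]
    linarith
  · rcases Nat.eq_zero_or_pos n with rfl | hn
    · simp [hk]
    · have : (1 : ℝ) ≤ n := by exact_mod_cast hn
      exact one_div_le_one_div_of_le (by positivity) (pow_le_pow_right₀ this (by omega))

lemma summable_norm_bernoulli_mul_pow {z : ℂ} (hz : ‖z‖ < 2 * π) :
    Summable fun n : ℕ => ‖((bernoulli n : ℚ) : ℂ) / (n.factorial : ℂ) * z ^ n‖ := by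
  have hg : Summable fun n : ℕ => π ^ 2 / 3 * (‖z‖ / (2 * π)) ^ n :=
    (summable_geometric_of_lt_one (by positivity)
      ((div_lt_one (by positivity)).2 hz)).mul_left _
  refine hg.of_norm_bounded_eventually_nat ?_
  filter_upwards [Filter.eventually_ge_atTop 2] with n hn
  rcases Nat.even_or_odd' n with ⟨k, rfl | rfl⟩
  · have h := abs_bernoulli_two_mul_div_factorial_le (k := k) (by omega)
    have e : ‖((bernoulli (2 * k) : ℚ) : ℂ) / ((2 * k).factorial : ℂ)‖ =
        |(bernoulli (2 * k) : ℝ) / ((2 * k).factorial : ℝ)| := by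
      rw [← Real.norm_eq_abs, ← Complex.norm_real]
      push_cast
      rfl
    rw [norm_norm, norm_mul, e, norm_pow, div_pow, ← mul_div_assoc, mul_div_right_comm]
    gcongr
  · rw [bernoulli_eq_zero_of_odd ⟨k, rfl⟩ (by omega)]
    simp
    positivity

lemma hasSum_coeff_exp_sub_one (z : ℂ) :
    HasSum (fun n : ℕ => PowerSeries.coeff n (PowerSeries.exp ℂ - 1) * z ^ n)
      (Complex.exp z - 1) := by
  have h := NormedSpace.expSeries_div_hasSum_exp z
  rw [← Complex.exp_eq_exp_ℂ] at h
  refine (h.sub (hasSum_ite_eq 0 (1 : ℂ))).congr_fun fun n => ?_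
  rcases eq_or_ne n 0 with rfl | hn
  · simp
  · simp [PowerSeries.coeff_exp, PowerSeries.coeff_one, hn, div_eq_inv_mul]

/-- The generating function of the Bernoulli numbers, as an identity of convergent series. -/
lemma tsum_bernoulli_mul_exp_sub_one {z : ℂ} (hz : ‖z‖ < 2 * π) :
    (∑' n : ℕ, ((bernoulli n : ℚ) : ℂ) / (n.factorial : ℂ) * z ^ n) * (Complex.exp z - 1) = z := by
  have he := hasSum_coeff_exp_sub_one z
  rw [← he.tsum_eq, tsum_mul_tsum_eq_tsum_sum_antidiagonal_of_summable_norm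
    (summable_norm_bernoulli_mul_pow hz) he.summable.norm]
  have hc : ∀ n : ℕ, ∑ p ∈ Finset.HasAntidiagonal.antidiagonal n,
      ((bernoulli p.1 : ℚ) : ℂ) / (p.1.factorial : ℂ) * z ^ p.1 *
        (PowerSeries.coeff p.2 (PowerSeries.exp ℂ - 1) * z ^ p.2) =
      if n = 1 then z else 0 := by
    intro n
    have h := congrArg (PowerSeries.coeff n) (bernoulliPowerSeries_mul_exp_sub_one ℂ)
    rw [PowerSeries.coeff_mul, PowerSeries.coeff_X] at h
    trans (if n = 1 then (1 : ℂ) else 0) * z ^ n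
    · rw [← h, Finset.sum_mul]
      refine Finset.sum_congr rfl fun p hp => ?_
      rw [← Finset.HasAntidiagonal.mem_antidiagonal.1 hp, pow_add]
      simp [bernoulliPowerSeries]
      ring
    · split_ifs with h1 <;> simp [h1]
  simp_rw [hc]
  simp

/-- With `z = t * I`, this is `z / (2 sinh (z / 2)) = 2 g(z / 2) - g(z)` for `g(z) = z / (exp z - 1)`. -/
lemma hasSum_half_div_sin_half {t : ℝ} (ht0 : 0 < |t|) (ht : |t| < 2 * π) :
    HasSum (fun n : ℕ => ((2 : ℂ) * (1 / 2) ^ n - 1) *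
      (((bernoulli n : ℚ) : ℂ) / (n.factorial : ℂ) * (t * Complex.I) ^ n))
      (((t / 2) / Real.sin (t / 2) : ℝ) : ℂ) := by
  have hz : ‖(t : ℂ) * Complex.I‖ < 2 * π := by simpa using ht
  have hz2 : ‖(t : ℂ) * Complex.I / 2‖ < 2 * π := by
    rw [norm_div]
    norm_num
    have := Real.pi_pos
    linarith
  have h1 := (summable_norm_bernoulli_mul_pow hz).of_norm.hasSum
  have h2 := (summable_norm_bernoulli_mul_pow hz2).of_norm.hasSum
  have e1 := tsum_bernoulli_mul_exp_sub_one hz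
  have e2 := tsum_bernoulli_mul_exp_sub_one hz2
  have hs : Real.sin (t / 2) ≠ 0 := by
    intro h
    have := (Real.sin_eq_zero_iff_of_lt_of_lt (by linarith [(abs_lt.1 ht).1])
      (by linarith [(abs_lt.1 ht).2])).1 h
    exact (abs_pos.1 ht0) (by linarith)
  convert! (h2.mul_left 2).sub h1 using 1
  · ext n
    rw [div_pow, div_pow, one_pow]
    ring
  · generalize (∑' n : ℕ, (_ : ℂ)) = a at e1 ⊢
    generalize (∑' n : ℕ, (_ : ℂ)) = b at e2 ⊢
    have hsc : Complex.sin (t / 2) ≠ 0 := by exact_mod_cast hs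
    push_cast
    rw [div_eq_iff hsc, Complex.sin]
    have ew : Complex.exp (-(t / 2 : ℂ) * Complex.I) * Complex.exp ((t : ℂ) * Complex.I / 2) = 1 := by
      rw [← Complex.exp_add, ← Complex.exp_zero]
      congr 1
      ring
    have ew2 : Complex.exp ((t : ℂ) * Complex.I) = Complex.exp ((t : ℂ) * Complex.I / 2) ^ 2 := by
      rw [← Complex.exp_nat_mul]
      congr 1
      push_cast
      ring
    rw [show (t / 2 : ℂ) * Complex.I = t * Complex.I / 2 by ring]
    rw [ew2] at e1
    set w := Complex.exp ((t : ℂ) * Complex.I / 2)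
    set v := Complex.exp (-(t / 2 : ℂ) * Complex.I)
    have hw : w ≠ 0 := right_ne_zero_of_mul_eq_one ew
    apply mul_right_cancel₀ hw
    have key : (2 * b - a) * (w ^ 2 - 1) = t * Complex.I * w := by
      linear_combination 2 * (w + 1) * e2 - e1
    linear_combination (2 * b - a) * Complex.I / 2 * (-ew) + Complex.I / 2 * key + t * w / 2 * Complex.I_sq

/-- For every real `t` with `0 < |t| < 2π`, the series
`Σ_{n=1}^∞ (−1)^{n−1}(1 − 2^{1−2n}) B_{2n} t^{2n}/(2n)!` converges and
`(t/2)/sin(t/2) = 1 + Σ_{n=1}^∞ (−1)^{n−1}(1 − 2^{1−2n}) B_{2n} t^{2n}/(2n)!`,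
where `B_n` are the Bernoulli numbers (with `B_1 = −1/2`). -/
theorem stmt7 (t : ℝ) (ht0 : 0 < |t|) (ht : |t| < 2 * π) :
    Summable
      (fun n : ℕ =>
        (-1 : ℝ) ^ n * (1 - (2 : ℝ) ^ ((1 : ℤ) - 2 * ((n : ℤ) + 1))) *
          (bernoulli (2 * (n + 1)) : ℝ) * t ^ (2 * (n + 1)) /
          ((2 * (n + 1)).factorial : ℝ)) ∧
    (t / 2) / Real.sin (t / 2) =
      1 + ∑' n : ℕ,
        (-1 : ℝ) ^ n * (1 - (2 : ℝ) ^ ((1 : ℤ) - 2 * ((n : ℤ) + 1))) *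
          (bernoulli (2 * (n + 1)) : ℝ) * t ^ (2 * (n + 1)) /
          ((2 * (n + 1)).factorial : ℝ) := by
  have h := hasSum_half_div_sin_half ht0 ht
  have hinj : Function.Injective fun k : ℕ => 2 * k := fun a b hab => by
    simpa using hab
  rw [← hinj.hasSum_iff] at h
  · rw [← hasSum_nat_add_iff' 1] at h
    have h' := Complex.hasSum_re h
    have hs : HasSum (fun n : ℕ =>
        (-1 : ℝ) ^ n * (1 - (2 : ℝ) ^ ((1 : ℤ) - 2 * ((n : ℤ) + 1))) *
          (bernoulli (2 * (n + 1)) : ℝ) * t ^ (2 * (n + 1)) /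
          ((2 * (n + 1)).factorial : ℝ)) ((t / 2) / Real.sin (t / 2) - 1) := by
      convert! h' using 1
      · ext n
        have e2 : (2 : ℝ) ^ ((1 : ℤ) - 2 * ((n : ℤ) + 1)) = 2 * (1 / 2) ^ (2 * (n + 1)) := by
          rw [zpow_sub₀ two_ne_zero, zpow_one, div_pow, one_pow, mul_one_div]
          congr 1
        rw [e2, ← Complex.ofReal_re (_ / _)]
        congr 1
        simp only [Function.comp]
        rw [mul_pow, pow_mul Complex.I, Complex.I_sq, pow_succ (-1 : ℂ)]
        push_cast
        ring
      · rw [Complex.sub_re, Complex.ofReal_re]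
        norm_num
    exact ⟨hs.summable, by rw [hs.tsum_eq]; ring⟩
  · intro n hn
    have ho : Odd n := by
      rw [← Nat.not_even_iff_odd]
      rintro ⟨k, rfl⟩
      exact hn ⟨k, by simp; ring⟩
    rcases eq_or_ne n 1 with rfl | h1
    · norm_num
    · rw [bernoulli_eq_zero_of_odd ho (by have := ho.pos; omega)]
      simp
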